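/- arXiv:2112.10172 — 4 statements merged into one kernel-verified Lean document; each statement's English description precedes it below -/
import Mathlib

section
/- If (t, s) ∈ J(𝓕) and s' ∈ ℤ^ω satisfies |s'_k| ≤ |s_k| for every k ∈ ℕ, then (t, s') ∈ J(𝓕). Consequently s' ∈ 𝕊 and t_{s'} ≤ t_s. -/
noncomputable section
open Topology Filter TopologicalSpace

/- The dynamical model: F(t) = 3^t − 1 acting on ℝ × ℤ^ω (ℤ discrete, product topology). -/

/-- `F t = 3 ^ t - 1` (real exponent). -/
def F : ℝ → ℝ := fun t => (3 : ℝ) ^ t - 1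

/-- The inverse of `F` on `[0, ∞)`: `F⁻¹ t = log₃ (t + 1)`. -/
def Finv : ℝ → ℝ := fun t => Real.logb 3 (t + 1)

/-- The shift map on integer sequences. -/
def shift : (ℕ → ℤ) → (ℕ → ℤ) := fun s n => s (n + 1)

/-- The map 𝓕(t, s) = (F(t) − |s₀|, σ(s)). -/
def calF : ℝ × (ℕ → ℤ) → ℝ × (ℕ → ℤ) :=
  fun x => (F x.1 - (|x.2 0| : ℝ), shift x.2)

/-- J(𝓕) = {x : T(𝓕ⁿ(x)) ≥ 0 for all n ≥ 0} (the case n = 0 forces T(x) ≥ 0). -/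
def J : Set (ℝ × (ℕ → ℤ)) := {x | ∀ n : ℕ, 0 ≤ (calF^[n] x).1}

/-- 𝕊 = {s ∈ ℤ^ω : (t, s) ∈ J(𝓕) for some t ≥ 0}. -/
def Sset : Set (ℕ → ℤ) := {s | ∃ t : ℝ, 0 ≤ t ∧ (t, s) ∈ J}

/-- t_s = min {t ≥ 0 : (t, s) ∈ J(𝓕)} (as an infimum; for s ∈ 𝕊 it is attained). -/
def tmin (s : ℕ → ℤ) : ℝ := sInf {t : ℝ | (t, s) ∈ J}

/-- The endpoint set E(𝓕) = {(t_s, s) : s ∈ 𝕊}, a subspace of ℝ × ℤ^ω. -/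
def Efan : Set (ℝ × (ℕ → ℤ)) := {x | x.2 ∈ Sset ∧ x.1 = tmin x.2}

/-- t*_s = sup_{k ≥ 1} F^{−k}(|s_k|). -/
def tstar (s : ℕ → ℤ) : ℝ := ⨆ k : ℕ, Finv^[k + 1] (|s (k + 1)| : ℝ)

/-- X_n = {x ∈ E(𝓕) : t*_{σ^{2k²}(s(x))} > F^{k−n}(1) for all k > n}. -/
def Xfan (n : ℕ) : Set ↥Efan :=
  {x | ∀ k : ℕ, n < k → F^[k - n] 1 < tstar (shift^[2 * k ^ 2] (x : ℝ × (ℕ → ℤ)).2)}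

theorem F_mono : Monotone F := fun _ _ hab =>
  sub_le_sub_right (Real.rpow_le_rpow_of_exponent_le (by norm_num) hab) 1

/-- The orbit of `𝓕` is monotone in the starting height and antitone in the moduli of the
entries of the address. -/
theorem calF_iterate_fst_le {s s' : ℕ → ℤ} (hle : ∀ k : ℕ, |s' k| ≤ |s k|) {t t' : ℝ}
    (ht : t ≤ t') (n : ℕ) : (calF^[n] (t, s)).1 ≤ (calF^[n] (t', s')).1 := by
  induction n generalizing s s' t t' with
  | zero => exact ht
  | succ n ih =>
    simp only [Function.iterate_succ_apply]
    refine ih (fun k => hle (k + 1)) (sub_le_sub (F_mono ht) ?_)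
    exact_mod_cast hle 0

theorem mem_J_of_abs_le {t : ℝ} {s s' : ℕ → ℤ} (h : (t, s) ∈ J)
    (hle : ∀ k : ℕ, |s' k| ≤ |s k|) : (t, s') ∈ J :=
  fun n => (h n).trans (calF_iterate_fst_le hle le_rfl n)

/-- If (t, s) ∈ J(𝓕) and |s'_k| ≤ |s_k| for all k, then (t, s') ∈ J(𝓕);
consequently s' ∈ 𝕊 and t_{s'} ≤ t_s. -/
theorem J_mono_in_coordinates (t : ℝ) (s s' : ℕ → ℤ)
    (h : (t, s) ∈ J) (hle : ∀ k : ℕ, |s' k| ≤ |s k|) :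
    (t, s') ∈ J ∧ s' ∈ Sset ∧ tmin s' ≤ tmin s := by
  have h' := mem_J_of_abs_le h hle
  refine ⟨h', ⟨t, h 0, h'⟩, csInf_le_csInf ⟨0, fun u hu => hu 0⟩ ⟨t, h⟩ ?_⟩
  exact fun u hu => mem_J_of_abs_le hu hle
end
end

section
/- With K_n = {x ∈ 𝔈_c : ‖x‖ ≤ n+1} and E_n = {y ∈ σ𝔈_c : y_i ∈ K_n for 1 ≤ i ≤ n and y_i = 𝟎 for all i > n} (the first coordinate y_0 unrestricted), one has: σ𝔈_c = ⋃_{n} E_n, and for each n the set E_n is crowded (has no isolated points in its subspace topology) and is a nowhere dense subset of the subspace E_{n+1}. -/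
/- Complete Erdős space 𝔈_c, realized inside the real Hilbert space ℓ². -/

noncomputable section
open Topology Filter TopologicalSpace

/-- The set of points of ℓ² all of whose coordinates lie in {0} ∪ {1/(m+1) : m ∈ ℕ}. -/
def ErdosSet : Set (lp (fun _ : ℕ => ℝ) 2) :=
  {x | ∀ n : ℕ, x n = 0 ∨ ∃ m : ℕ, x n = 1 / (m + 1)}

/-- Complete Erdős space 𝔈_c, with the subspace (norm) topology from ℓ². -/
abbrev Ec := ↥ErdosSet

/-- The σ-product σ𝔈_c ⊆ 𝔈_c^ω : sequences which are the zero point of 𝔈_c in all but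
finitely many coordinates, with the subspace topology from the product 𝔈_c^ω. -/
def sigmaErdos : Set (ℕ → Ec) :=
  {y | {n : ℕ | (y n : lp (fun _ : ℕ => ℝ) 2) ≠ 0}.Finite}

/-- K_n = {x ∈ 𝔈_c : ‖x‖ ≤ n + 1}. -/
def Kball (n : ℕ) : Set Ec := {x | ‖(x : lp (fun _ : ℕ => ℝ) 2)‖ ≤ n + 1}

/-- E_n = {y ∈ σ𝔈_c : y_i ∈ K_n for 1 ≤ i ≤ n, and y_i = 𝟎 for i > n}. -/
def Eseq (n : ℕ) : Set ↥sigmaErdos :=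
  {y | (∀ i : ℕ, 1 ≤ i → i ≤ n → (y : ℕ → Ec) i ∈ Kball n) ∧
       ∀ i : ℕ, n < i → (((y : ℕ → Ec) i : lp (fun _ : ℕ => ℝ) 2)) = 0}

/-- The coordinate to put in position `k` in order to move `x` slightly: `0` if `x k ≠ 0`,
and `1 / (k + 1)` otherwise. -/
def flipCoord (x : Ec) (k : ℕ) : ℝ := if x.1 k = 0 then 1 / ((k : ℝ) + 1) else 0

lemma flipCoord_ne (x : Ec) (k : ℕ) : flipCoord x k ≠ x.1 k := by
  unfold flipCoord
  split_ifs with h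
  · rw [h]; positivity
  · exact Ne.symm h

/-- The point of complete Erdős space obtained from `x` by changing its `k`-th coordinate
to `flipCoord x k`. -/
def flipPoint (x : Ec) (k : ℕ) : Ec :=
  ⟨x.1 + lp.single 2 k (flipCoord x k - x.1 k), fun n => by
    rcases eq_or_ne n k with rfl | h
    · have : (x.1 + lp.single 2 n (flipCoord x n - x.1 n) : lp (fun _ : ℕ => ℝ) 2) n = flipCoord x n := by
        simp
      rw [this, flipCoord]
      split_ifs
      · exact Or.inr ⟨n, rfl⟩
      · exact Or.inl rfl
    · have : (x.1 + lp.single 2 k (flipCoord x k - x.1 k) : lp (fun _ : ℕ => ℝ) 2) n = x.1 n := by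
        simp [h]
      rw [this]
      exact x.2 n⟩

lemma flipPoint_ne (x : Ec) (k : ℕ) : flipPoint x k ≠ x := by
  intro h
  have h1 : (flipPoint x k).1 k = x.1 k := by rw [h]
  have h2 : (flipPoint x k).1 k = flipCoord x k := by simp [flipPoint]
  exact flipCoord_ne x k (h2.symm.trans h1)

lemma tendsto_coord_zero (x : lp (fun _ : ℕ => ℝ) 2) :
    Tendsto (fun k => x k) atTop (𝓝 0) := by
  have h := (lp.hasSum_single (p := 2) (by simp) x).summable.tendsto_atTop_zero.norm
  rw [tendsto_zero_iff_norm_tendsto_zero]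
  simpa [lp.norm_single] using h

lemma tendsto_flipPoint (x : Ec) : Tendsto (flipPoint x) atTop (𝓝 x) := by
  have hc : Tendsto (flipCoord x) atTop (𝓝 0) := by
    refine squeeze_zero (fun k => ?_) (fun k => ?_)
      (tendsto_one_div_add_atTop_nhds_zero_nat (𝕜 := ℝ))
    · unfold flipCoord; split_ifs <;> positivity
    · unfold flipCoord; split_ifs
      · exact le_rfl
      · positivity
  have hd := (hc.sub (tendsto_coord_zero x.1)).norm
  rw [tendsto_subtype_rng, tendsto_iff_norm_sub_tendsto_zero]
  simpa [flipPoint, lp.norm_single, -lp.single_sub] using hd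

lemma norm_flipPoint_le_one {x : Ec} (hx : x.1 = 0) (k : ℕ) : ‖(flipPoint x k).1‖ ≤ 1 := by
  have h : flipCoord x k = 1 / ((k : ℝ) + 1) := by simp [flipCoord, hx]
  have hk : (0 : ℝ) ≤ k := k.cast_nonneg
  have h1 : 1 / ((k : ℝ) + 1) ≤ 1 := by
    rw [div_le_one (by positivity)]; linarith
  have h2 : (flipPoint x k).1 = lp.single 2 k (1 / ((k : ℝ) + 1)) := by
    simp [flipPoint, hx, h]
  rw [h2, lp.norm_single (by simp), Real.norm_of_nonneg (by positivity)]
  exact h1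

/-- The point of the σ-product obtained from `y` by applying `flipPoint` at index `i`. -/
def flipAt (y : sigmaErdos) (i k : ℕ) : sigmaErdos :=
  ⟨Function.update y.1 i (flipPoint (y.1 i) k), by
    refine (Set.Finite.insert i y.2).subset fun j hj => ?_
    by_cases h : j = i
    · exact Or.inl h
    · right
      simpa [h] using hj⟩

lemma flipAt_same (y : sigmaErdos) (i k : ℕ) : (flipAt y i k).1 i = flipPoint (y.1 i) k := by
  simp [flipAt]

lemma flipAt_of_ne (y : sigmaErdos) {i j : ℕ} (h : j ≠ i) (k : ℕ) :
    (flipAt y i k).1 j = y.1 j := by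
  simp [flipAt, h]

lemma flipAt_ne (y : sigmaErdos) (i k : ℕ) : flipAt y i k ≠ y := by
  intro h
  apply flipPoint_ne (y.1 i) k
  rw [← flipAt_same, h]

lemma tendsto_flipAt (y : sigmaErdos) (i : ℕ) : Tendsto (flipAt y i) atTop (𝓝 y) := by
  rw [tendsto_subtype_rng]
  simpa [flipAt] using (tendsto_const_nhds (x := y.1)).update i (tendsto_flipPoint (y.1 i))

lemma continuous_coord (i : ℕ) :
    Continuous fun y : sigmaErdos => ((y.1 i : Ec) : lp (fun _ : ℕ => ℝ) 2) :=
  continuous_subtype_val.comp ((continuous_apply i).comp continuous_subtype_val)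

lemma isClosed_Eseq (n : ℕ) : IsClosed (Eseq n) := by
  have : Eseq n = (⋂ i, ⋂ (_ : 1 ≤ i), ⋂ (_ : i ≤ n), {y : sigmaErdos | ‖(y.1 i).1‖ ≤ n + 1}) ∩
      ⋂ i, ⋂ (_ : n < i), {y : sigmaErdos | (y.1 i).1 = 0} := by
    ext y
    simp [Eseq, Kball]
  rw [this]
  refine IsClosed.inter ?_ ?_
  · exact isClosed_iInter fun i => isClosed_iInter fun _ => isClosed_iInter fun _ =>
      isClosed_le (continuous_coord i).norm continuous_const
  · exact isClosed_iInter fun i => isClosed_iInter fun _ =>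
      isClosed_eq (continuous_coord i) continuous_const

lemma Eseq_subset_succ (n : ℕ) : Eseq n ⊆ Eseq (n + 1) := by
  rintro y ⟨h1, h2⟩
  refine ⟨fun i hi hin => ?_, fun i hi => h2 i (by omega)⟩
  simp only [Kball, Set.mem_ofPred_eq]
  rcases Nat.lt_or_ge n i with h | h
  · rw [h2 i h, norm_zero]; positivity
  · have := h1 i hi h
    simp only [Kball, Set.mem_ofPred_eq] at this
    push_cast
    linarith

lemma iUnion_Eseq : (⋃ n, Eseq n) = Set.univ := by
  refine Set.eq_univ_of_forall fun y => Set.mem_iUnion.2 ?_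
  obtain ⟨N, hN⟩ := y.2.bddAbove
  obtain ⟨C, hC⟩ := ((Set.finite_Iic N).image fun i => ‖(y.1 i).1‖).bddAbove
  obtain ⟨M, hM⟩ := exists_nat_ge C
  have hzero : ∀ i, N < i → (y.1 i).1 = 0 := fun i hi => by
    by_contra h
    exact absurd (hN h) (not_le.2 hi)
  refine ⟨max N M, fun i _ _ => ?_, fun i hi => hzero i ((le_max_left _ _).trans_lt hi)⟩
  simp only [Kball, Set.mem_ofPred_eq]
  rcases Nat.lt_or_ge N i with h | h
  · rw [hzero i h, norm_zero]; positivity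
  · have h1 : ‖(y.1 i).1‖ ≤ C := hC ⟨i, h, rfl⟩
    have h2 : (M : ℝ) ≤ (max N M : ℕ) := by exact_mod_cast le_max_right N M
    linarith

lemma flipAt_zero_mem_Eseq {n : ℕ} {y : sigmaErdos} (hy : y ∈ Eseq n) (k : ℕ) :
    flipAt y 0 k ∈ Eseq n := by
  refine ⟨fun i hi hin => ?_, fun i hi => ?_⟩ <;> rw [flipAt_of_ne y (by omega)]
  exacts [hy.1 i hi hin, hy.2 i hi]

lemma flipAt_succ_mem_Eseq_succ {n : ℕ} {y : sigmaErdos} (hy : y ∈ Eseq n) (k : ℕ) :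
    flipAt y (n + 1) k ∈ Eseq (n + 1) := by
  refine ⟨fun i hi hin => ?_, fun i hi => ?_⟩
  · rcases eq_or_ne i (n + 1) with rfl | h
    · rw [flipAt_same]
      have := norm_flipPoint_le_one (hy.2 (n + 1) (by omega)) k
      simp only [Kball, Set.mem_ofPred_eq]
      push_cast
      linarith [n.cast_nonneg (α := ℝ)]
    · rw [flipAt_of_ne y h]
      exact (Eseq_subset_succ n hy).1 i hi hin
  · rw [flipAt_of_ne y (by omega)]
    exact hy.2 i (by omega)

lemma flipAt_succ_notMem_Eseq {n : ℕ} {y : sigmaErdos} (hy : y ∈ Eseq n) (k : ℕ) :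
    flipAt y (n + 1) k ∉ Eseq n := by
  intro h
  have h1 := h.2 (n + 1) (by omega)
  rw [flipAt_same] at h1
  exact flipPoint_ne _ k (Subtype.ext (h1.trans (hy.2 (n + 1) (by omega)).symm))

/-- σ𝔈_c = ⋃ₙ Eₙ, each Eₙ is crowded, and each Eₙ is a nowhere dense
subset of the subspace E_{n+1}. -/
theorem Eseq_union_crowded_nowhereDense :
    (⋃ n, Eseq n) = Set.univ ∧
    (∀ n, ∀ x ∈ Eseq n, (nhdsWithin x (Eseq n \ {x})).NeBot) ∧
    (∀ n, Eseq n ⊆ Eseq (n + 1) ∧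
      IsNowhereDense {y : ↥(Eseq (n + 1)) | (y : ↥sigmaErdos) ∈ Eseq n}) := by
  refine ⟨iUnion_Eseq, fun n x hx => ?_, fun n => ⟨Eseq_subset_succ n, ?_⟩⟩
  · have h : Tendsto (flipAt x 0) atTop (𝓝[Eseq n \ {x}] x) :=
      tendsto_nhdsWithin_iff.2 ⟨tendsto_flipAt x 0, Eventually.of_forall fun k =>
        ⟨flipAt_zero_mem_Eseq hx k, flipAt_ne x 0 k⟩⟩
    exact h.neBot
  · have hcl : IsClosed {y : ↥(Eseq (n + 1)) | (y : ↥sigmaErdos) ∈ Eseq n} :=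
      (isClosed_Eseq n).preimage continuous_subtype_val
    rw [IsNowhereDense, hcl.closure_eq, Set.eq_empty_iff_forall_notMem]
    intro y hy
    have hyn : y ∈ {y : ↥(Eseq (n + 1)) | (y : ↥sigmaErdos) ∈ Eseq n} := interior_subset hy
    change y.1 ∈ Eseq n at hyn
    have ht : Tendsto (fun k => (⟨flipAt y.1 (n + 1) k, flipAt_succ_mem_Eseq_succ hyn k⟩ :
        Eseq (n + 1))) atTop (𝓝 y) :=
      tendsto_subtype_rng.2 (tendsto_flipAt y.1 (n + 1))
    obtain ⟨k, hk⟩ := (ht.eventually (mem_interior_iff_mem_nhds.1 hy)).exists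
    exact flipAt_succ_notMem_Eseq hyn k hk
end
end

section
/- Complete Erdős space 𝔈_c is cohesive: every point x ∈ 𝔈_c has a neighborhood U such that no nonempty subset of U is a clopen subset of 𝔈_c. -/
/- Complete Erdős space 𝔈_c, realized inside the real Hilbert space ℓ². -/

noncomputable section
open Topology Filter TopologicalSpace

/-- The set `{0} ∪ {1/(m+1) : m ∈ ℕ}` is closed in `ℝ`. -/
lemma isClosed_zero_or_one_div :
    IsClosed {t : ℝ | t = 0 ∨ ∃ m : ℕ, t = 1 / (m + 1)} := by
  have h := (tendsto_one_div_add_atTop_nhds_zero_nat (𝕜 := ℝ)).isCompact_insert_range.isClosed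
  convert h using 1
  ext t
  simp [eq_comm]

lemma isClosed_erdosSet : IsClosed ErdosSet := by
  have h : ErdosSet = ⋂ n : ℕ, (fun x : lp (fun _ : ℕ => ℝ) 2 => x n) ⁻¹'
      {t : ℝ | t = 0 ∨ ∃ m : ℕ, t = 1 / (m + 1)} := by
    ext x
    simp [ErdosSet]
  rw [h]
  refine isClosed_iInter fun n => isClosed_zero_or_one_div.preimage ?_
  exact (continuous_apply n).comp (lp.uniformContinuous_coe (p := 2)).continuous

lemma Ec.nonneg (x : Ec) (n : ℕ) : 0 ≤ x.1 n := by
  rcases x.2 n with h | ⟨m, h⟩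
  · exact h.ge
  · rw [h]
    positivity

/-- Replacing one coordinate of a point of `Ec` by `1/(m+1)`. -/
lemma Ec.exists_update (x : Ec) (m n : ℕ) :
    ∃ y : Ec, y.1 n = 1 / (m + 1) ∧ (∀ i ≠ n, y.1 i = x.1 i) ∧
      dist x y = |1 / ((m : ℝ) + 1) - x.1 n| := by
  have hn : (x.1 + lp.single 2 n (1 / ((m : ℝ) + 1) - x.1 n) : lp (fun _ : ℕ => ℝ) 2) n
      = 1 / (m + 1) := by
    simp
  have hi : ∀ i ≠ n, (x.1 + lp.single 2 n (1 / ((m : ℝ) + 1) - x.1 n) :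
      lp (fun _ : ℕ => ℝ) 2) i = x.1 i := by
    intro i hi
    simp [Pi.single_eq_of_ne hi]
  refine ⟨⟨_, fun i => ?_⟩, hn, hi, ?_⟩
  · by_cases h : i = n
    · subst h
      exact Or.inr ⟨m, hn⟩
    · rw [hi i h]
      exact x.2 i
  · rw [Subtype.dist_eq, dist_self_add_right, lp.norm_single (by norm_num), Real.norm_eq_abs]

/-- Orthogonality-type estimate for coordinatewise ordered nonnegative sequences. -/
lemma norm_sub_sq_le_of_nonneg_of_le {x y : lp (fun _ : ℕ => ℝ) 2}
    (hx : ∀ n, 0 ≤ x n) (hxy : ∀ n, x n ≤ y n) :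
    ‖y - x‖ ^ 2 ≤ ‖y‖ ^ 2 - ‖x‖ ^ 2 := by
  have h0 : 0 ≤ inner ℝ x (y - x) := by
    rw [lp.inner_eq_tsum]
    refine tsum_nonneg fun n => ?_
    have := mul_nonneg (sub_nonneg.2 (hxy n)) (hx n)
    simpa using this
  have h1 := norm_add_sq_real x (y - x)
  rw [add_sub_cancel] at h1
  linarith

/-- Increasing finitely many coordinates of a point of a bounded set `C ⊆ Ec`, one gets
arbitrarily close to the complement of `C` before leaving `C`. -/
lemma exists_ge_near_compl {C : Set Ec} {R : ℝ} (hR : ∀ x ∈ C, ‖x.1‖ ≤ R) {x : Ec}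
    (hx : x ∈ C) {ε : ℝ} (hε : 0 < ε) :
    ∃ y ∈ C, (∀ n, x.1 n ≤ y.1 n) ∧ ∃ z ∉ C, dist y z < ε := by
  by_contra! H
  obtain ⟨m, hm⟩ := exists_nat_one_div_lt hε
  have hδ : (0 : ℝ) < 1 / ((m : ℝ) + 1) := by positivity
  have hlim : Tendsto (fun n => x.1 n) atTop (𝓝 0) := by
    have h := (lp.memℓp x.1).summable (by norm_num)
    have h2 : Summable fun n => (x.1 n) ^ 2 := by
      simpa using h
    have h3 := h2.tendsto_atTop_zero.sqrt
    simpa [Real.sqrt_sq (Ec.nonneg x _)] using h3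
  obtain ⟨N, hN⟩ := eventually_atTop.1 (hlim.eventually_le_const hδ)
  have key : ∀ j : ℕ, ∃ y ∈ C, (∀ n, x.1 n ≤ y.1 n) ∧
      (∀ i < j, y.1 (N + i) = 1 / ((m : ℝ) + 1)) ∧
      ∀ n ≥ N + j, y.1 n = x.1 n := by
    intro j
    induction j with
    | zero => exact ⟨x, hx, fun _ => le_rfl, by simp, fun _ _ => rfl⟩
    | succ j ih =>
      obtain ⟨y, hyC, hxy, hy, hyx⟩ := ih
      obtain ⟨z, hz, hzi, hd⟩ := Ec.exists_update y m (N + j)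
      have hle := hN (N + j) (by omega)
      refine ⟨z, ?_, fun n => ?_, fun i hi => ?_, fun n hn => ?_⟩
      · by_contra hzC
        have h1 := H y hyC hxy z hzC
        rw [hd, hyx _ le_rfl, abs_of_nonneg (sub_nonneg.2 hle)] at h1
        linarith [Ec.nonneg x (N + j)]
      · by_cases h : n = N + j
        · rw [h, hz]
          exact hle
        · rw [hzi n h]
          exact hxy n
      · by_cases h : i = j
        · rw [h, hz]
        · rw [hzi _ (by omega), hy i (by omega)]
      · rw [hzi n (by omega), hyx n (by omega)]
  obtain ⟨j, hj⟩ := exists_nat_gt (R ^ 2 / (1 / ((m : ℝ) + 1)) ^ 2)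
  obtain ⟨y, hyC, -, hy, -⟩ := key j
  have hsum := lp.sum_rpow_le_norm_rpow (p := 2) (by norm_num) y.1
    ((Finset.range j).map (addLeftEmbedding N))
  have hsum' : ∑ i ∈ Finset.range j, (y.1 (N + i)) ^ 2 ≤ ‖y.1‖ ^ 2 := by
    simpa using hsum
  rw [Finset.sum_congr rfl fun i hi => by rw [hy i (Finset.mem_range.1 hi)],
    Finset.sum_const, Finset.card_range, nsmul_eq_mul] at hsum'
  rw [div_lt_iff₀ (by positivity)] at hj
  have := pow_le_pow_left₀ (norm_nonneg _) (hR y hyC) 2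
  linarith

/-- A coordinatewise increasing, norm bounded sequence in `Ec` converges in `Ec`. -/
lemma exists_tendsto_of_monotone_of_bounded {u : ℕ → Ec} {R : ℝ}
    (hu : ∀ k n, (u k).1 n ≤ (u (k + 1)).1 n) (hR : ∀ k, ‖(u k).1‖ ≤ R) :
    ∃ z, Tendsto u atTop (𝓝 z) := by
  have : CompleteSpace Ec := isClosed_erdosSet.completeSpace_coe
  refine cauchySeq_tendsto_of_complete ?_
  have hmono : ∀ n, Monotone fun k => (u k).1 n := fun n =>
    monotone_nat_of_le_succ fun k => hu k n
  have hest : ∀ k l, k ≤ l → dist (u k) (u l) ^ 2 ≤ ‖(u l).1‖ ^ 2 - ‖(u k).1‖ ^ 2 := by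
    intro k l hkl
    rw [dist_comm, Subtype.dist_eq, dist_eq_norm]
    exact norm_sub_sq_le_of_nonneg_of_le (Ec.nonneg _) fun n => hmono n hkl
  have hnorm : Monotone fun k => ‖(u k).1‖ ^ 2 := fun k l hkl => by
    have := hest k l hkl
    have := sq_nonneg (dist (u k) (u l))
    dsimp only
    linarith
  have hbdd : BddAbove (Set.range fun k => ‖(u k).1‖ ^ 2) := by
    refine ⟨R ^ 2, ?_⟩
    rintro _ ⟨k, rfl⟩
    exact pow_le_pow_left₀ (norm_nonneg _) (hR k) 2
  have hc := (tendsto_atTop_ciSup hnorm hbdd).cauchySeq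
  rw [Metric.cauchySeq_iff'] at hc ⊢
  intro ε hε
  obtain ⟨N, hN⟩ := hc (ε ^ 2) (by positivity)
  refine ⟨N, fun n hn => ?_⟩
  have h1 := hest N n hn
  have h2 := (le_abs_self _).trans_lt (hN n hn)
  rw [dist_comm]
  exact lt_of_pow_lt_pow_left₀ 2 hε.le (h1.trans_lt h2)

/-- Nonempty clopen subsets of `Ec` are unbounded in norm. -/
lemma not_isClopen_of_norm_le {C : Set Ec} {R : ℝ} (hR : ∀ x ∈ C, ‖x.1‖ ≤ R)
    (hne : C.Nonempty) : ¬ IsClopen C := by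
  intro hC
  obtain ⟨x₀, hx₀⟩ := hne
  have step : ∀ (k : ℕ) (x : C), ∃ y : C, (∀ n, x.1.1 n ≤ y.1.1 n) ∧
      ∃ z ∉ C, dist y.1 z < 1 / ((k : ℝ) + 1) := by
    intro k x
    obtain ⟨y, hy, h⟩ := exists_ge_near_compl hR x.2 (ε := 1 / ((k : ℝ) + 1)) (by positivity)
    exact ⟨⟨y, hy⟩, h⟩
  choose f hf g hgC hg using step
  let u : ℕ → C := fun k => Nat.rec ⟨x₀, hx₀⟩ f k
  obtain ⟨z, hz⟩ := exists_tendsto_of_monotone_of_bounded (u := fun k => (u k).1)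
    (fun k n => hf k (u k) n) fun k => hR _ (u k).2
  have hzC : z ∈ C := hC.isClosed.mem_of_tendsto hz (Eventually.of_forall fun k => (u k).2)
  have hdist : Tendsto (fun k => dist (u (k + 1)).1 (g k (u k))) atTop (𝓝 0) :=
    squeeze_zero (fun _ => dist_nonneg) (fun k => (hg k (u k)).le)
      tendsto_one_div_add_atTop_nhds_zero_nat
  have hgz : Tendsto (fun k => g k (u k)) atTop (𝓝 z) :=
    (tendsto_iff_of_dist hdist).1 ((tendsto_add_atTop_iff_nat 1).2 hz)
  exact hC.compl.isClosed.mem_of_tendsto hgz (Eventually.of_forall fun k => hgC k (u k)) hzC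

/-- 𝔈_c is cohesive: every point has a neighborhood containing no nonempty
clopen subset of 𝔈_c. -/
theorem Ec_cohesive (x : Ec) :
    ∃ U ∈ nhds x, ∀ C : Set Ec, C ⊆ U → C.Nonempty → ¬ IsClopen C := by
  refine ⟨Metric.ball x 1, Metric.ball_mem_nhds x one_pos, fun C hC hne => ?_⟩
  refine not_isClopen_of_norm_le (R := 1 + ‖x.1‖) (fun y hy => ?_) hne
  have h : ‖y.1 - x.1‖ < 1 := by
    simpa [Subtype.dist_eq, dist_eq_norm] using hC hy
  linarith [norm_le_norm_sub_add y.1 x.1]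
end
end

section
/- Let 𝒲 be the topology on 𝔈_c induced by the inclusion of 𝔈_c into the product space ℝ^ℕ (topology of coordinatewise convergence). Then every point of 𝔈_c has a neighborhood basis, in the norm topology of 𝔈_c, consisting of sets that are compact with respect to 𝒲; in particular 𝒲 is a witness topology for 𝔈_c. -/
/- Complete Erdős space 𝔈_c, realized inside the real Hilbert space ℓ². -/

noncomputable section
open Topology Filter TopologicalSpace

/- Witness topologies and relative notions, stated with explicit topologies to avoid
instance ambiguity between the original topology τ and the witness topology W. -/

/-- `W` is a witness topology for `(E, τ)`: `W` is coarser than `τ`, `(E, W)` is separable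
and metrizable, and every point has a `τ`-neighborhood basis of `W`-closed sets. -/
def IsWitness {E : Type*} (τ W : TopologicalSpace E) : Prop :=
  τ ≤ W ∧ @TopologicalSpace.SeparableSpace E W ∧ @TopologicalSpace.MetrizableSpace E W ∧
    ∀ x : E, ∀ U ∈ @nhds E τ x, ∃ V ∈ @nhds E τ x, V ⊆ U ∧ @IsClosed E W V

/-- The subspace `A` of `(E, τ)` is crowded (has no isolated points). -/
def Crowded {E : Type*} (τ : TopologicalSpace E) (A : Set E) : Prop :=
  ∀ x ∈ A, (@nhdsWithin E τ x (A \ {x})).NeBot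

/-- `A` is a nowhere dense subset of the subspace `B` of `(E, τ)`. -/
def NowhereDenseIn {E : Type*} (τ : TopologicalSpace E) (A B : Set E) : Prop :=
  A ⊆ B ∧ @IsNowhereDense ↥B (@instTopologicalSpaceSubtype E (· ∈ B) τ)
    {y : ↥B | (y : E) ∈ A}

/-- `C` is a clopen subset of the subspace `A` of `(E, τ)`. -/
def ClopenIn {E : Type*} (τ : TopologicalSpace E) (A C : Set E) : Prop :=
  C ⊆ A ∧ @IsClopen ↥A (@instTopologicalSpaceSubtype E (· ∈ A) τ)
    {y : ↥A | (y : E) ∈ C}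

/-- The norm (subspace-of-ℓ²) topology of 𝔈_c. -/
def EcTop : TopologicalSpace Ec := inferInstance

/-- The topology 𝒲 on 𝔈_c induced by the inclusion of 𝔈_c into ℝ^ℕ
(topology of coordinatewise convergence). -/
def Wpt : TopologicalSpace Ec :=
  TopologicalSpace.induced
    (fun x : Ec => fun n : ℕ => ((x : lp (fun _ : ℕ => ℝ) 2) n : ℝ))
    Pi.topologicalSpace

/-- The set of admissible coordinates of points of 𝔈_c. -/
def coordSet : Set ℝ := {t | t = 0 ∨ ∃ m : ℕ, t = 1 / (m + 1)}

theorem isCompact_coordSet : IsCompact coordSet := by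
  have h : coordSet = insert 0 (Set.range fun m : ℕ => (1 / (m + 1) : ℝ)) := by
    ext t
    simp only [coordSet, Set.mem_ofPred_eq, Set.mem_insert_iff, Set.mem_range, eq_comm]
  rw [h]
  exact tendsto_one_div_add_atTop_nhds_zero_nat.isCompact_insert_range

/-- The coordinate map from 𝔈_c to ℝ^ℕ. -/
def coordMap (x : Ec) : ℕ → ℝ := fun n => (x : lp (fun _ : ℕ => ℝ) 2) n

theorem coordMap_injective : Function.Injective coordMap := fun _ _ h =>
  Subtype.ext (Subtype.ext h)

theorem continuous_coordMap : Continuous coordMap :=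
  lp.uniformContinuous_coe.continuous.comp continuous_subtype_val

theorem isEmbedding_coordMap : @IsEmbedding Ec (ℕ → ℝ) Wpt _ coordMap :=
  @IsEmbedding.mk _ _ Wpt _ _ (@IsInducing.mk _ _ Wpt _ _ rfl) coordMap_injective

/-- The sequences with admissible coordinates whose ℓ²-distance to `a` is at most `r`. -/
def coordBall (a : ℕ → ℝ) (r : ℝ) : Set (ℕ → ℝ) :=
  {f | (∀ n, f n ∈ coordSet) ∧ ∀ s : Finset ℕ, ∑ i ∈ s, ‖f i - a i‖ ^ (2 : ℝ) ≤ r ^ (2 : ℝ)}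

theorem isCompact_coordBall (a : ℕ → ℝ) (r : ℝ) : IsCompact (coordBall a r) := by
  have h : coordBall a r = (Set.univ.pi fun _ => coordSet) ∩
      ⋂ s : Finset ℕ, {f | ∑ i ∈ s, ‖f i - a i‖ ^ (2 : ℝ) ≤ r ^ (2 : ℝ)} := by
    ext f
    simp [coordBall]
  rw [h]
  refine (isCompact_univ_pi fun _ => isCompact_coordSet).inter_right
    (isClosed_iInter fun s => isClosed_le ?_ continuous_const)
  refine continuous_finsetSum _ fun i _ => ?_
  exact ((continuous_apply i).sub continuous_const).norm.rpow_const fun _ => Or.inr (by norm_num)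

theorem coordBall_subset_range (x : Ec) (r : ℝ) :
    coordBall (coordMap x) r ⊆ Set.range coordMap := by
  rintro f ⟨hf, hs⟩
  have hd : Memℓp (E := fun _ : ℕ => ℝ) (f - coordMap x) 2 := by
    refine memℓp_gen' (C := r ^ (2 : ℝ)) fun s => ?_
    simpa using hs s
  have hm : Memℓp (E := fun _ : ℕ => ℝ) f 2 := by
    have h := hd.add (lp.memℓp (x : lp (fun _ : ℕ => ℝ) 2))
    rwa [show f - coordMap x + (x : lp (fun _ : ℕ => ℝ) 2) = f from sub_add_cancel f _] at h
  exact ⟨⟨⟨f, hm⟩, hf⟩, rfl⟩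

theorem coordMap_preimage_coordBall (x : Ec) {r : ℝ} (hr : 0 ≤ r) :
    coordMap ⁻¹' coordBall (coordMap x) r = Metric.closedBall x r := by
  have h2 : (0 : ℝ) < (2 : ENNReal).toReal := by norm_num
  ext y
  rw [Metric.mem_closedBall, Subtype.dist_eq, dist_eq_norm]
  constructor
  · rintro ⟨-, hs⟩
    refine lp.norm_le_of_forall_sum_le h2 hr fun s => ?_
    simpa [coordMap] using hs s
  · intro h
    refine ⟨y.2, fun s => ?_⟩
    have h1 := lp.sum_rpow_le_norm_rpow h2 (y.1 - x.1) s
    have h3 := Real.rpow_le_rpow (norm_nonneg _) h h2.le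
    simpa [coordMap] using h1.trans h3

theorem isCompact_closedBall_Wpt (x : Ec) {r : ℝ} (hr : 0 ≤ r) :
    @IsCompact Ec Wpt (Metric.closedBall x r) := by
  rw [← coordMap_preimage_coordBall x hr]
  exact (@IsInducing.isCompact_preimage_iff _ _ Wpt _ _
    (@IsEmbedding.toIsInducing _ _ Wpt _ _ isEmbedding_coordMap) (coordBall (coordMap x) r)
    (coordBall_subset_range x r)).2 (isCompact_coordBall _ r)

/-- Every point of 𝔈_c has a neighborhood basis (in the norm topology)
of 𝒲-compact sets; in particular 𝒲 is a witness topology for 𝔈_c. -/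
theorem Ec_has_Wcompact_nbhd_basis :
    (∀ x : Ec, ∀ U ∈ @nhds Ec EcTop x, ∃ V ∈ @nhds Ec EcTop x,
      V ⊆ U ∧ @IsCompact Ec Wpt V) ∧
    IsWitness EcTop Wpt := by
  have basis : ∀ x : Ec, ∀ U ∈ @nhds Ec EcTop x, ∃ V ∈ @nhds Ec EcTop x,
      V ⊆ U ∧ @IsCompact Ec Wpt V := by
    intro x U hU
    obtain ⟨r, hr, hrU⟩ := Metric.nhds_basis_closedBall.mem_iff.1 hU
    exact ⟨Metric.closedBall x r, Metric.closedBall_mem_nhds x hr, hrU,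
      isCompact_closedBall_Wpt x hr.le⟩
  have metrizable : @MetrizableSpace Ec Wpt :=
    @IsEmbedding.metrizableSpace _ _ Wpt _ _ _ isEmbedding_coordMap
  have separable : @SeparableSpace Ec Wpt :=
    @SecondCountableTopology.to_separableSpace _ Wpt
      (@IsEmbedding.secondCountableTopology _ _ Wpt _ _ _ isEmbedding_coordMap)
  refine ⟨basis, continuous_iff_le_induced.1 continuous_coordMap, separable, metrizable, ?_⟩
  intro x U hU
  obtain ⟨V, hV, hVU, hVc⟩ := basis x U hU
  have t2 : @T2Space Ec Wpt := @IsEmbedding.t2Space _ _ Wpt _ _ _ isEmbedding_coordMap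
  exact ⟨V, hV, hVU, @IsCompact.isClosed _ Wpt t2 V hVc⟩
end
end
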